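/- Let k ≥ 2 and n ≥ 4k−2 be integers. Then the maximum number of edges of a C_{2k+1}-free graph on n vertices equals ⌊n²/4⌋; that is, every C_{2k+1}-free graph on n vertices has at most ⌊n²/4⌋ edges, and there exists a C_{2k+1}-free graph on n vertices with exactly ⌊n²/4⌋ edges. -/

import Mathlib

/-- A graph `G` is `Cₘ`-free if it contains no subgraph isomorphic to the cycle of length `m`. -/
def CycleFree {V : Type*} (G : SimpleGraph V) (m : ℕ) : Prop :=
  ∀ f : SimpleGraph.cycleGraph m →g G, ¬ Function.Injective f

variable {V : Type*}

/-- There is a path from `a` to `b` whose vertex set is `S`. -/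
inductive PathOn [DecidableEq V] (G : SimpleGraph V) : V → V → Finset V → Prop
  | single (a : V) : PathOn G a a {a}
  | cons {a b c : V} {S : Finset V} :
      G.Adj a b → a ∉ S → PathOn G b c S → PathOn G a c (insert a S)

namespace PathOn

variable [DecidableEq V] {G : SimpleGraph V}

lemma append {a b c d : V} {S T : Finset V} (h₁ : PathOn G a b S) (h₂ : PathOn G c d T)
    (hbc : G.Adj b c) (hd : Disjoint S T) : PathOn G a d (S ∪ T) := by
  induction h₁ with
  | single a =>
    rw [Finset.disjoint_singleton_left] at hd
    simpa [← Finset.insert_eq] using cons hbc hd h₂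
  | cons hab ha _ ih =>
    rw [Finset.disjoint_insert_left] at hd
    rw [Finset.insert_union]
    exact cons hab (by simp [ha, hd.1]) (ih hbc hd.2)

lemma symm {a b : V} {S : Finset V} (h : PathOn G a b S) : PathOn G b a S := by
  induction h with
  | single a => exact single a
  | cons hab ha _ ih =>
    rw [Finset.insert_eq, Finset.union_comm]
    exact ih.append (single _) hab.symm (by simpa using ha)

lemma ofFun {y : ℕ → V} {i j : ℕ} (hij : i ≤ j)
    (hinj : Set.InjOn y (Set.Icc i j)) (hadj : ∀ t, i ≤ t → t < j → G.Adj (y t) (y (t + 1))) :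
    PathOn G (y i) (y j) ((Finset.Icc i j).image y) := by
  induction j, hij using Nat.le_induction with
  | base => simpa using single (y i)
  | succ j hij ih =>
    have h := (ih (hinj.mono (Set.Icc_subset_Icc_right (by omega)))
      (fun t h₁ h₂ => hadj t h₁ (by omega))).append (single (y (j + 1)))
      (hadj j hij (by omega)) (by
        rw [Finset.disjoint_singleton_right, Finset.mem_image]
        rintro ⟨t, ht, hty⟩
        rw [Finset.mem_Icc] at ht
        have := hinj (Set.mem_Icc.2 ⟨ht.1, by omega⟩) (Set.mem_Icc.2 ⟨by omega, le_rfl⟩) hty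
        omega)
    convert h using 1
    rw [← Finset.image_singleton, ← Finset.image_union]
    congr 1
    ext t
    simp only [Finset.mem_Icc, Finset.mem_union, Finset.mem_singleton]
    omega

lemma exists_fun {a b : V} {S : Finset V} (h : PathOn G a b S) :
    ∃ (y : ℕ → V) (r : ℕ), S.card = r + 1 ∧ y 0 = a ∧ y r = b ∧ Set.InjOn y (Set.Iic r) ∧
      (∀ t < r, G.Adj (y t) (y (t + 1))) ∧ ∀ t ≤ r, y t ∈ S := by
  induction h with
  | single a => exact ⟨fun _ => a, 0, by simp [Set.InjOn]⟩
  | @cons a b c S hab ha _ ih =>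
    obtain ⟨y, r, hr, h0, hl, hinj, hadj, hS⟩ := ih
    refine ⟨fun t => if t = 0 then a else y (t - 1), r + 1, ?_, ?_, ?_, ?_, ?_, ?_⟩
    · rw [Finset.card_insert_of_notMem ha, hr]
    · simp
    · simp [hl]
    · intro i hi j hj hij
      simp only [Set.mem_Iic] at hi hj
      rcases Nat.eq_zero_or_pos i with rfl | hi0 <;> rcases Nat.eq_zero_or_pos j with rfl | hj0
      · rfl
      · simp only [↓reduceIte, hj0.ne'] at hij
        exact absurd (hij ▸ hS (j - 1) (by omega)) ha
      · simp only [↓reduceIte, hi0.ne'] at hij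
        exact absurd (hij ▸ hS (i - 1) (by omega)) ha
      · simp only [hi0.ne', hj0.ne', ↓reduceIte] at hij
        have := hinj (Set.mem_Iic.2 (by omega)) (Set.mem_Iic.2 (by omega)) hij
        omega
    · intro t ht
      rcases Nat.eq_zero_or_pos t with rfl | ht0
      · simpa [h0] using hab
      · have := hadj (t - 1) (by omega)
        rw [Nat.sub_add_cancel ht0] at this
        simpa [ht0.ne'] using this
    · intro t ht
      rcases Nat.eq_zero_or_pos t with rfl | ht0
      · simp
      · simpa [ht0.ne'] using Or.inr (hS (t - 1) (by omega))

end PathOn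

/-- `G` has a cycle on `m` vertices, where an edge counts as a cycle on two vertices. -/
def HasCycle [DecidableEq V] (G : SimpleGraph V) (m : ℕ) : Prop :=
  ∃ (a b : V) (S : Finset V), PathOn G a b S ∧ G.Adj b a ∧ S.card = m

/-- `p` runs periodically around a cycle of length `c`. -/
structure IsCyc (G : SimpleGraph V) (p : ℕ → V) (c : ℕ) : Prop where
  periodic : ∀ t, p (t + c) = p t
  adj : ∀ t, G.Adj (p t) (p (t + 1))
  inj : ∀ i < c, ∀ j < c, p i = p j → i = j

namespace IsCyc

variable {G : SimpleGraph V} {p : ℕ → V} {c : ℕ}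

lemma mod (h : IsCyc G p c) (t : ℕ) : p (t % c) = p t := by
  have : ∀ q, p (t % c + c * q) = p (t % c) := by
    intro q
    induction q with
    | zero => simp
    | succ q ih => rw [Nat.mul_succ, ← Nat.add_assoc, h.periodic, ih]
  rw [← this (t / c), Nat.mod_add_div]

lemma shift (h : IsCyc G p c) (s : ℕ) : IsCyc G (fun t => p (t + s)) c where
  periodic t := by
    have := h.periodic (t + s)
    simpa only [Nat.add_right_comm] using this
  adj t := by
    have := h.adj (t + s)
    simpa only [Nat.add_right_comm] using this
  inj i hi j hj hij := by
    change p (i + s) = p (j + s) at hij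
    rw [← h.mod (i + s), ← h.mod (j + s)] at hij
    have hc : 0 < c := by omega
    have := h.inj _ (Nat.mod_lt _ hc) _ (Nat.mod_lt _ hc) hij
    have h2 : i ≡ j [MOD c] := Nat.ModEq.add_right_cancel' s this
    exact Nat.ModEq.eq_of_lt_of_lt h2 hi hj

lemma adj_last (h : IsCyc G p c) (hc : 0 < c) : G.Adj (p (c - 1)) (p 0) := by
  have := h.adj (c - 1)
  rwa [Nat.sub_add_cancel hc, ← Nat.zero_add c, h.periodic, Nat.zero_add] at this

variable [DecidableEq V]

lemma image_shift (h : IsCyc G p c) (hc : 0 < c) (s : ℕ) :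
    (Finset.range c).image (fun t => p (t + s)) = (Finset.range c).image p := by
  refine Finset.eq_of_subset_of_card_le ?_ ?_
  · intro v hv
    obtain ⟨t, _, rfl⟩ := Finset.mem_image.1 hv
    exact Finset.mem_image.2
      ⟨(t + s) % c, Finset.mem_range.2 (Nat.mod_lt _ hc), h.mod _⟩
  · rw [Finset.card_image_of_injOn, Finset.card_image_of_injOn]
    · intro i hi j hj
      exact (h.shift s).inj i (by simpa using hi) j (by simpa using hj)
    · intro i hi j hj
      exact h.inj i (by simpa using hi) j (by simpa using hj)

lemma card_image (h : IsCyc G p c) : ((Finset.range c).image p).card = c := by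
  rw [Finset.card_image_of_injOn, Finset.card_range]
  intro i hi j hj
  exact h.inj i (by simpa using hi) j (by simpa using hj)

lemma card_image_Icc (h : IsCyc G p c) {i j : ℕ} (hj : j < c) :
    ((Finset.Icc i j).image p).card = j + 1 - i := by
  rw [Finset.card_image_of_injOn, Nat.card_Icc]
  intro a ha b hb
  rw [Finset.coe_Icc, Set.mem_Icc] at ha hb
  exact h.inj a (by omega) b (by omega)

lemma pathOn (h : IsCyc G p c) {i j : ℕ} (hij : i ≤ j) (hj : j < c) :
    PathOn G (p i) (p j) ((Finset.Icc i j).image p) := by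
  refine PathOn.ofFun hij (fun a ha b hb => ?_) (fun t _ _ => h.adj t)
  rw [Set.mem_Icc] at ha hb
  exact h.inj a (by omega) b (by omega)

lemma disjoint_image (h : IsCyc G p c) {i j i' j' : ℕ} (hj : j < c) (hj' : j' < c)
    (hd : j < i' ∨ j' < i) :
    Disjoint ((Finset.Icc i j).image p) ((Finset.Icc i' j').image p) := by
  rw [Finset.disjoint_left]
  intro v hv hv'
  obtain ⟨a, ha, rfl⟩ := Finset.mem_image.1 hv
  obtain ⟨b, hb, hab⟩ := Finset.mem_image.1 hv'
  rw [Finset.mem_Icc] at ha hb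
  have := h.inj b (by omega) a (by omega) hab
  omega

lemma image_Icc_subset {i j : ℕ} (hj : j < c) :
    (Finset.Icc i j).image p ⊆ (Finset.range c).image p := by
  refine Finset.image_subset_image fun t ht => ?_
  rw [Finset.mem_Icc] at ht
  rw [Finset.mem_range]
  omega

end IsCyc

lemma HasCycle.exists_isCyc [DecidableEq V] {G : SimpleGraph V} {m : ℕ} (h : HasCycle G m) :
    ∃ p, IsCyc G p m := by
  obtain ⟨a, b, S, hp, hba, rfl⟩ := h
  obtain ⟨y, r, hr, rfl, rfl, hinj, hadj, -⟩ := hp.exists_fun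
  rw [hr]
  refine ⟨fun t => y (t % (r + 1)), fun t => by simp, fun t => ?_, fun i hi j hj hij => ?_⟩
  · have hlt : t % (r + 1) < r + 1 := Nat.mod_lt t (Nat.succ_pos r)
    change G.Adj (y (t % (r + 1))) (y ((t + 1) % (r + 1)))
    rw [← Nat.mod_add_mod]
    rcases Nat.lt_or_ge (t % (r + 1)) r with h | h
    · rw [Nat.mod_eq_of_lt (a := t % (r + 1) + 1) (by omega)]
      exact hadj _ h
    · have : t % (r + 1) = r := by omega
      rw [this, Nat.mod_self]
      exact hba
  · simp only [Nat.mod_eq_of_lt hi, Nat.mod_eq_of_lt hj] at hij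
    exact hinj (Set.mem_Iic.2 (by omega)) (Set.mem_Iic.2 (by omega)) hij

section Counting

variable (G : SimpleGraph V) [DecidableRel G.Adj]

/-- The number of neighbours of `v` in `X`. -/
def degOn (X : Finset V) (v : V) : ℕ := (X.filter (G.Adj v)).card

/-- Twice the number of edges inside `X`. -/
def adjPairs (X : Finset V) : ℕ := ∑ v ∈ X, degOn G X v

variable {G}

lemma adjPairs_univ [Fintype V] : adjPairs G Finset.univ = 2 * G.edgeSet.ncard := by
  classical
  rw [← SimpleGraph.coe_edgeFinset, Set.ncard_coe_finset, ← G.sum_degrees_eq_twice_card_edges]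
  refine Finset.sum_congr rfl fun v _ => ?_
  rw [degOn, ← SimpleGraph.card_neighborFinset_eq_degree, SimpleGraph.neighborFinset_eq_filter]

lemma degOn_mono {X Y : Finset V} (h : X ⊆ Y) (v : V) : degOn G X v ≤ degOn G Y v :=
  Finset.card_le_card (Finset.filter_subset_filter _ h)

lemma sum_degOn_comm (X Y : Finset V) : ∑ v ∈ X, degOn G Y v = ∑ v ∈ Y, degOn G X v := by
  simp only [degOn, Finset.card_filter]
  rw [Finset.sum_comm]
  simp only [G.adj_comm]

lemma degOn_lt_card {X : Finset V} {v : V} (hv : v ∈ X) : degOn G X v < X.card :=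
  Finset.card_lt_card (Finset.filter_ssubset.2 ⟨v, hv, G.loopless.irrefl v⟩)

lemma adjPairs_le (X : Finset V) : adjPairs G X ≤ X.card * (X.card - 1) := by
  rw [← smul_eq_mul]
  exact Finset.sum_le_card_nsmul _ _ _ fun v hv => Nat.le_sub_one_of_lt (degOn_lt_card hv)

variable [DecidableEq V]

lemma degOn_sdiff_add {S X : Finset V} (h : S ⊆ X) (v : V) :
    degOn G (X \ S) v + degOn G S v = degOn G X v := by
  rw [degOn, degOn, degOn, ← Finset.card_union_of_disjoint, ← Finset.filter_union,
    Finset.sdiff_union_of_subset h]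
  exact Finset.disjoint_filter_filter Finset.sdiff_disjoint

lemma degOn_union {X Y : Finset V} (h : Disjoint X Y) (v : V) :
    degOn G (X ∪ Y) v = degOn G X v + degOn G Y v := by
  rw [degOn, degOn, degOn, ← Finset.card_union_of_disjoint, ← Finset.filter_union]
  exact Finset.disjoint_filter_filter h

lemma adjPairs_sdiff {S X : Finset V} (h : S ⊆ X) :
    adjPairs G X = adjPairs G (X \ S) + ∑ s ∈ S, (degOn G (X \ S) s + degOn G X s) := by
  have h₁ : adjPairs G X = ∑ v ∈ X \ S, degOn G X v + ∑ v ∈ S, degOn G X v :=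
    (Finset.sum_sdiff h).symm
  have h₂ : ∑ v ∈ X \ S, degOn G X v
      = adjPairs G (X \ S) + ∑ v ∈ X \ S, degOn G S v := by
    rw [adjPairs, ← Finset.sum_add_distrib]
    exact Finset.sum_congr rfl fun v _ => (degOn_sdiff_add h v).symm
  rw [h₁, h₂, sum_degOn_comm, Finset.sum_add_distrib]
  omega

/-- A set `S` with no edges inside reduces the bound `adjPairs_le`. -/
lemma adjPairs_add_le_of_independent {S X : Finset V} (h : S ⊆ X)
    (hS : ∀ s ∈ S, ∀ t ∈ S, ¬ G.Adj s t) :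
    adjPairs G X + S.card * (S.card - 1) ≤ X.card * (X.card - 1) := by
  have hS0 : ∀ s ∈ S, degOn G X s + (S.card - 1) ≤ X.card - 1 := by
    intro s hs
    have h0 : degOn G S s = 0 := by
      rw [degOn, Finset.card_eq_zero, Finset.filter_eq_empty_iff]
      exact fun t ht => hS s hs t ht
    have h1 := degOn_sdiff_add (G := G) h s
    have h2 : degOn G (X \ S) s ≤ (X \ S).card := Finset.card_filter_le _ _
    rw [Finset.card_sdiff_of_subset h] at h2
    have := Finset.card_pos.2 ⟨s, hs⟩
    have := Finset.card_le_card h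
    omega
  have h₁ : adjPairs G X = ∑ v ∈ X \ S, degOn G X v + ∑ v ∈ S, degOn G X v :=
    (Finset.sum_sdiff h).symm
  have h₂ : ∑ v ∈ X \ S, degOn G X v ≤ (X \ S).card • (X.card - 1) :=
    Finset.sum_le_card_nsmul _ _ _ fun v hv =>
      Nat.le_sub_one_of_lt (degOn_lt_card (Finset.mem_sdiff.1 hv).1)
  have h₃ : ∑ v ∈ S, (degOn G X v + (S.card - 1)) ≤ S.card • (X.card - 1) :=
    Finset.sum_le_card_nsmul _ _ _ hS0
  rw [Finset.sum_add_distrib, Finset.sum_const, smul_eq_mul, smul_eq_mul] at h₃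
  rw [smul_eq_mul] at h₂
  have h₄ : (X \ S).card + S.card = X.card := Finset.card_sdiff_add_card_eq_card h
  have h₅ : X.card * (X.card - 1) = (X \ S).card * (X.card - 1) + S.card * (X.card - 1) := by
    rw [← Nat.add_mul, h₄]
  omega

end Counting

section Bondy

variable [DecidableEq V] {G : SimpleGraph V} {p : ℕ → V} {c l : ℕ}

lemma hasCycle_of_near_chords (h : IsCyc G p c) (hl : 3 ≤ l) {j : ℕ} (hj : l - 1 ≤ j) (hjc : j < c)
    (h₀ : G.Adj (p 0) (p j)) (h₁ : G.Adj (p 1) (p (j + 3 - l))) : HasCycle G l := by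
  have hP := (h.pathOn (i := 0) (j := 1) (by omega) (by omega)).append
    (h.pathOn (i := j + 3 - l) (j := j) (by omega) hjc) h₁
    (h.disjoint_image (by omega) hjc (by omega))
  refine ⟨_, _, _, hP, h₀.symm, ?_⟩
  rw [Finset.card_union_of_disjoint (h.disjoint_image (by omega) hjc (by omega)),
    h.card_image_Icc (by omega), h.card_image_Icc hjc]
  omega

lemma hasCycle_of_crossing_chords (h : IsCyc G p c) (hlc : l ≤ c) {j : ℕ} (hj : 1 ≤ j)
    (hjl : j ≤ l - 2) (h₀ : G.Adj (p 0) (p j)) (h₁ : G.Adj (p 1) (p (j + c + 1 - l))) :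
    HasCycle G l := by
  have hd := h.disjoint_image (i := 1) (j := j) (i' := j + c + 1 - l) (j' := c - 1)
    (by omega) (by omega) (by omega)
  have hd₀ := h.disjoint_image (i := 0) (j := 0) (i' := 1) (j' := j)
    (by omega) (by omega) (by omega)
  have hd₁ := h.disjoint_image (i := 0) (j := 0) (i' := j + c + 1 - l) (j' := c - 1)
    (by omega) (by omega) (by omega)
  have hP := (h.pathOn (i := 0) (j := 0) le_rfl (by omega)).append
    ((h.pathOn (i := 1) (j := j) hj (by omega)).symm.append
      (h.pathOn (i := j + c + 1 - l) (j := c - 1) (by omega) (by omega)) h₁ hd) h₀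
    (Finset.disjoint_union_right.2 ⟨hd₀, hd₁⟩)
  refine ⟨_, _, _, hP, h.adj_last (by omega), ?_⟩
  rw [Finset.card_union_of_disjoint (Finset.disjoint_union_right.2 ⟨hd₀, hd₁⟩),
    Finset.card_union_of_disjoint hd, h.card_image_Icc (by omega), h.card_image_Icc (by omega),
    h.card_image_Icc (by omega)]
  omega

variable [DecidableRel G.Adj]

lemma IsCyc.degOn_image (h : IsCyc G p c) (v : V) :
    degOn G ((Finset.range c).image p) v = ((Finset.range c).filter fun j => G.Adj v (p j)).card := by
  rw [degOn, Finset.filter_image, Finset.card_image_of_injOn]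
  intro i hi j hj
  simp only [Finset.coe_filter, Finset.mem_range, Set.mem_ofPred_eq] at hi hj
  exact h.inj i hi.1 j hj.1

lemma degOn_add_degOn_succ_le (h : IsCyc G p c) (hl : 3 ≤ l) (hlc : l ≤ c) (hno : ¬ HasCycle G l) :
    degOn G ((Finset.range c).image p) (p 0) + degOn G ((Finset.range c).image p) (p 1) ≤ c := by
  rw [h.degOn_image, h.degOn_image]
  set A := (Finset.Ico 2 c).filter fun j => G.Adj (p 0) (p j)
  set B := (Finset.Ico 2 c).filter fun j => G.Adj (p 1) (p j)
  have hA : ((Finset.range c).filter fun j => G.Adj (p 0) (p j)) ⊆ insert 1 A := by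
    intro j hj
    simp only [Finset.mem_filter, Finset.mem_range, Finset.mem_insert, A, Finset.mem_Ico] at hj ⊢
    have : j ≠ 0 := by rintro rfl; exact G.loopless.irrefl _ hj.2
    by_cases h1 : j = 1
    · exact Or.inl h1
    · exact Or.inr ⟨⟨by omega, hj.1⟩, hj.2⟩
  have hB : ((Finset.range c).filter fun j => G.Adj (p 1) (p j)) ⊆ insert 0 B := by
    intro j hj
    simp only [Finset.mem_filter, Finset.mem_range, Finset.mem_insert, B, Finset.mem_Ico] at hj ⊢
    have : j ≠ 1 := by rintro rfl; exact G.loopless.irrefl _ hj.2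
    by_cases h1 : j = 0
    · exact Or.inl h1
    · exact Or.inr ⟨⟨by omega, hj.1⟩, hj.2⟩
  have hA' := (Finset.card_le_card hA).trans (Finset.card_insert_le _ _)
  have hB' := (Finset.card_le_card hB).trans (Finset.card_insert_le _ _)
  have hAB : A.card ≤ (Finset.Ico 2 c \ B).card := by
    refine Finset.card_le_card_of_injOn
      (fun j => if l - 1 ≤ j then j + 3 - l else j + c + 1 - l) ?_ ?_
    · intro j hj
      simp only [A, B, Finset.coe_filter, Finset.mem_Ico, Set.mem_ofPred_eq, Finset.coe_sdiff,
        Finset.coe_Ico, Set.mem_sdiff, Set.mem_Ico] at hj ⊢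
      split_ifs with hjl
      · exact ⟨by omega, fun hb => hno (hasCycle_of_near_chords h hl hjl hj.1.2 hj.2 hb.2)⟩
      · exact ⟨by omega, fun hb => hno
          (hasCycle_of_crossing_chords h hlc (by omega) (by omega) hj.2 hb.2)⟩
    · intro i hi j hj hij
      simp only [A, Finset.coe_filter, Finset.mem_Ico, Set.mem_ofPred_eq] at hi hj hij
      split_ifs at hij <;> omega
  have hBc : (Finset.Ico 2 c \ B).card + B.card = c - 2 := by
    rw [Finset.card_sdiff_add_card_eq_card (Finset.filter_subset _ _), Nat.card_Ico]
  omega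

/-- **Bondy's theorem**: a graph with a Hamiltonian cycle on `c` vertices and more than `c² / 4`
edges is pancyclic. -/
lemma two_mul_adjPairs_image_le (h : IsCyc G p c) (hl : 3 ≤ l) (hlc : l ≤ c)
    (hno : ¬ HasCycle G l) : 2 * adjPairs G ((Finset.range c).image p) ≤ c * c := by
  set C := (Finset.range c).image p with hC
  have hsum : adjPairs G C = ∑ t ∈ Finset.range c, degOn G C (p t) := by
    rw [adjPairs]
    nth_rewrite 1 [hC]
    rw [Finset.sum_image]
    intro i hi j hj
    exact h.inj i (by simpa using hi) j (by simpa using hj)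
  have hsum' : ∑ t ∈ Finset.range c, degOn G C (p (t + 1))
      = ∑ t ∈ Finset.range c, degOn G C (p t) := by
    have h₁ := Finset.sum_range_succ (fun t => degOn G C (p t)) c
    have h₂ := Finset.sum_range_succ' (fun t => degOn G C (p t)) c
    have h₃ : p c = p 0 := by simpa using h.periodic 0
    rw [h₃] at h₁
    omega
  calc 2 * adjPairs G C
      = ∑ t ∈ Finset.range c, (degOn G C (p t) + degOn G C (p (t + 1))) := by
        rw [Finset.sum_add_distrib, hsum', hsum, two_mul]
    _ ≤ (Finset.range c).card • c := by
        refine Finset.sum_le_card_nsmul _ _ _ fun t _ => ?_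
        have := degOn_add_degOn_succ_le (h.shift t) hl hlc hno
        rwa [h.image_shift (by omega), ← hC, Nat.zero_add, Nat.add_comm 1 t] at this
    _ = c * c := by simp

end Bondy

section Rotation

/-- `y 0, …, y r` is a path of `G`. -/
structure IsPathFun (G : SimpleGraph V) (y : ℕ → V) (r : ℕ) : Prop where
  inj : ∀ i ≤ r, ∀ j ≤ r, y i = y j → i = j
  adj : ∀ i < r, G.Adj (y i) (y (i + 1))

/-- The Pósa rotation `y (i - 1), …, y 0, y i, y (i + 1), …` of the sequence `y`. -/
def rotate (y : ℕ → V) (i : ℕ) : ℕ → V := fun j => if j < i then y (i - 1 - j) else y j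

lemma rotate_of_lt (y : ℕ → V) {i j : ℕ} (h : j < i) : rotate y i j = y (i - 1 - j) := if_pos h

lemma rotate_of_le (y : ℕ → V) {i j : ℕ} (h : i ≤ j) : rotate y i j = y j := if_neg (by omega)

namespace IsPathFun

variable {G : SimpleGraph V} {y : ℕ → V} {r : ℕ}

lemma mono (h : IsPathFun G y r) {s : ℕ} (hs : s ≤ r) : IsPathFun G y s where
  inj i hi j hj := h.inj i (by omega) j (by omega)
  adj i hi := h.adj i (by omega)

lemma rotate (h : IsPathFun G y r) {i : ℕ} (hir : i ≤ r) (hadj : G.Adj (y 0) (y i)) :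
    IsPathFun G (rotate y i) r where
  inj a ha b hb hab := by
    simp only [_root_.rotate] at hab
    split_ifs at hab with h₁ h₂ h₂ <;>
    · have := h.inj _ (by omega) _ (by omega) hab
      omega
  adj a ha := by
    rcases lt_trichotomy (a + 1) i with hai | hai | hai
    · rw [rotate_of_lt y (by omega), rotate_of_lt y hai]
      have := h.adj (i - 1 - (a + 1)) (by omega)
      rw [show i - 1 - (a + 1) + 1 = i - 1 - a by omega] at this
      exact this.symm
    · rw [rotate_of_lt y (by omega), rotate_of_le y (by omega)]
      rwa [show i - 1 - a = 0 by omega, hai]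
    · rw [rotate_of_le y (by omega), rotate_of_le y (by omega)]
      exact h.adj a ha

lemma cons (h : IsPathFun G y r) {v : V} (hv : G.Adj (y 0) v) (hn : ∀ j ≤ r, v ≠ y j) :
    IsPathFun G (fun j => if j = 0 then v else y (j - 1)) (r + 1) where
  inj a ha b hb hab := by
    split_ifs at hab with h₁ h₂ h₂
    · omega
    · exact absurd hab (hn _ (by omega))
    · exact absurd hab.symm (hn _ (by omega))
    · have := h.inj _ (by omega) _ (by omega) hab
      omega
  adj a ha := by
    rcases Nat.eq_zero_or_pos a with rfl | h0
    · simpa using hv.symm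
    · have := h.adj (a - 1) (by omega)
      rw [Nat.sub_add_cancel h0] at this
      simpa [h0.ne'] using this

lemma reverse_concat (h : IsPathFun G y r) {v : V} (hv : G.Adj (y 0) v) (hn : ∀ j ≤ r, v ≠ y j) :
    IsPathFun G (fun j => if j ≤ r then y (r - j) else v) (r + 1) where
  inj a ha b hb hab := by
    split_ifs at hab with h₁ h₂ h₂
    · have := h.inj _ (by omega) _ (by omega) hab
      omega
    · exact absurd hab.symm (hn _ (by omega))
    · exact absurd hab (hn _ (by omega))
    · omega
  adj a ha := by
    rcases Nat.lt_or_ge a r with har | har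
    · have := h.adj (r - (a + 1)) (by omega)
      rw [show r - (a + 1) + 1 = r - a by omega] at this
      simpa [har.le, Nat.succ_le_of_lt har] using this.symm
    · obtain rfl : a = r := by omega
      simpa using hv

variable [DecidableEq V]

lemma pathOn (h : IsPathFun G y r) {i j : ℕ} (hij : i ≤ j) (hj : j ≤ r) :
    PathOn G (y i) (y j) ((Finset.Icc i j).image y) := by
  refine PathOn.ofFun hij (fun a ha b hb => ?_) (fun t _ _ => h.adj t (by omega))
  rw [Set.mem_Icc] at ha hb
  exact h.inj a (by omega) b (by omega)

lemma card_image_Icc (h : IsPathFun G y r) {j : ℕ} (hj : j ≤ r) :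
    ((Finset.Icc 0 j).image y).card = j + 1 := by
  rw [Finset.card_image_of_injOn, Nat.card_Icc, Nat.sub_zero]
  intro a ha b hb
  rw [Finset.coe_Icc, Set.mem_Icc] at ha hb
  exact h.inj a (by omega) b (by omega)

lemma lt_card (h : IsPathFun G y r) {U : Finset V} (hU : ∀ j ≤ r, y j ∈ U) : r < U.card := by
  have := Finset.card_le_card (s := (Finset.Icc 0 r).image y) (t := U) fun v hv => by
    obtain ⟨j, hj, rfl⟩ := Finset.mem_image.1 hv
    exact hU j (Finset.mem_Icc.1 hj).2
  rw [h.card_image_Icc le_rfl] at this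
  omega

lemma hasCycle (h : IsPathFun G y r) {j : ℕ} (hj : j ≤ r) (hadj : G.Adj (y 0) (y j)) :
    HasCycle G (j + 1) :=
  ⟨_, _, _, h.pathOn (Nat.zero_le j) hj, hadj.symm, h.card_image_Icc hj⟩

end IsPathFun

/-- In a class of paths closed under rotation whose initial vertices have all their neighbours on
the path, the rotations of a path with initial vertex of largest degree provide a set `S` of
vertices incident with few edges. -/
lemma exists_sum_degOn_le_of_rotate [DecidableEq V] {G : SimpleGraph V} [DecidableRel G.Adj]
    {X : Finset V} {P : (ℕ → V) → Prop} {R c : ℕ}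
    (hmax : ∀ m, c < m → ¬ HasCycle G m) (hpath : ∀ y, P y → IsPathFun G y R)
    (hrot : ∀ y, P y → ∀ i, 1 ≤ i → i ≤ R → G.Adj (y 0) (y i) → P (rotate y i))
    (hX : ∀ y, P y → ∀ j ≤ R, y j ∈ X)
    (hN : ∀ y, P y → ∀ v ∈ X, G.Adj (y 0) v → ∃ j ≤ R, v = y j) (hne : ∃ y, P y) :
    ∃ S, S.Nonempty ∧ (∀ s ∈ S, ∃ y, P y ∧ y 0 = s) ∧
      ∑ s ∈ S, (degOn G (X \ S) s + degOn G X s) ≤ min c (R + 1) * S.card := by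
  classical
  have hwin : ∀ y, P y → ∀ j ≤ R, G.Adj (y 0) (y j) → j < c := by
    intro y hy j hj hadj
    by_contra hcj
    exact hmax (j + 1) (by omega) ((hpath y hy).hasCycle hj hadj)
  obtain ⟨y₀, hy₀⟩ := hne
  obtain ⟨x, hx, hxmax⟩ := (X.filter fun v => ∃ y, P y ∧ y 0 = v).exists_max_image (degOn G X)
    ⟨y₀ 0, Finset.mem_filter.2 ⟨hX y₀ hy₀ 0 (Nat.zero_le _), y₀, hy₀, rfl⟩⟩
  obtain ⟨-, y, hy, rfl⟩ := Finset.mem_filter.1 hx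
  have hdeg : ∀ z, P z → degOn G X (z 0) ≤ degOn G X (y 0) := fun z hz =>
    hxmax _ (Finset.mem_filter.2 ⟨hX z hz 0 (Nat.zero_le _), z, hz, rfl⟩)
  have hyp := hpath y hy
  set I := (Finset.Icc 1 R).filter fun i => G.Adj (y 0) (y i) with hI
  have hIR : ∀ i ∈ I, 1 ≤ i ∧ i ≤ R ∧ i < c ∧ G.Adj (y 0) (y i) := by
    intro i hi
    obtain ⟨hi, hadj⟩ := Finset.mem_filter.1 hi
    rw [Finset.mem_Icc] at hi
    exact ⟨hi.1, hi.2, hwin y hy i hi.2 hadj, hadj⟩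
  have hIcard : degOn G X (y 0) = I.card := by
    have : X.filter (G.Adj (y 0)) = I.image y := by
      ext v
      simp only [Finset.mem_filter, Finset.mem_image]
      constructor
      · rintro ⟨hv, hadj⟩
        obtain ⟨j, hj, rfl⟩ := hN y hy v hv hadj
        have : j ≠ 0 := by rintro rfl; exact G.loopless.irrefl _ hadj
        exact ⟨j, Finset.mem_filter.2 ⟨Finset.mem_Icc.2 ⟨by omega, hj⟩, hadj⟩, rfl⟩
      · rintro ⟨j, hj, rfl⟩
        obtain ⟨-, hjR, -, hadj⟩ := hIR j hj
        exact ⟨hX y hy j hjR, hadj⟩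
    rw [degOn, this, Finset.card_image_of_injOn]
    intro i hi j hj
    exact hyp.inj i (hIR i hi).2.1 j (hIR j hj).2.1
  rcases I.eq_empty_or_nonempty with hI0 | hI0
  · refine ⟨{y 0}, Finset.singleton_nonempty _, by simpa using ⟨y, hy, rfl⟩, ?_⟩
    have h0 : degOn G X (y 0) = 0 := by rw [hIcard, hI0, Finset.card_empty]
    have h1 := degOn_mono (G := G) (Finset.sdiff_subset (s := X) (t := {y 0})) (y 0)
    rw [Finset.sum_singleton]
    omega
  have hScard : (I.image fun i => y (i - 1)).card = I.card := by
    refine Finset.card_image_of_injOn fun i hi j hj hij => ?_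
    have hi := hIR i hi
    have hj := hIR j hj
    have := hyp.inj _ (by omega) _ (by omega) hij
    omega
  set S := I.image fun i => y (i - 1) with hS
  have hrot0 : ∀ i ∈ I, P (rotate y i) ∧ rotate y i 0 = y (i - 1) := fun i hi => by
    obtain ⟨h1, hR, -, hadj⟩ := hIR i hi
    exact ⟨hrot y hy i h1 hR hadj, rotate_of_lt y (by omega)⟩
  refine ⟨S, hI0.image _, fun s hs => ?_, ?_⟩
  · obtain ⟨i, hi, rfl⟩ := Finset.mem_image.1 hs
    exact ⟨_, hrot0 i hi⟩
  set w := min c (R + 1) with hw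
  set W := (Finset.range w).image y with hW
  have hWcard : W.card ≤ w := Finset.card_image_le.trans (by simp)
  have hSW : S ⊆ W := by
    intro s hs
    obtain ⟨i, hi, rfl⟩ := Finset.mem_image.1 hs
    have := hIR i hi
    exact Finset.mem_image_of_mem _ (Finset.mem_range.2 (by omega))
  have hS_le : ∀ s ∈ S, degOn G (X \ S) s + degOn G X s ≤ w := by
    intro s hs
    obtain ⟨i, hi, rfl⟩ := Finset.mem_image.1 hs
    obtain ⟨hz, hz0⟩ := hrot0 i hi
    have hi' := hIR i hi
    have h₁ : degOn G X (y (i - 1)) ≤ S.card := by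
      rw [hScard, ← hIcard, ← hz0]
      exact hdeg _ hz
    have h₂ : degOn G (X \ S) (y (i - 1)) ≤ (W \ S).card := by
      refine Finset.card_le_card fun v hv => ?_
      simp only [Finset.mem_filter, Finset.mem_sdiff] at hv ⊢
      refine ⟨?_, hv.1.2⟩
      rw [← hz0] at hv
      obtain ⟨j, hj, rfl⟩ := hN _ hz v hv.1.1 hv.2
      have hjc := hwin _ hz j hj hv.2
      rcases Nat.lt_or_ge j i with hji | hji
      · rw [rotate_of_lt y hji]
        exact Finset.mem_image_of_mem _ (Finset.mem_range.2 (by omega))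
      · rw [rotate_of_le y hji]
        exact Finset.mem_image_of_mem _ (Finset.mem_range.2 (by omega))
    have h₃ := Finset.card_sdiff_add_card_eq_card hSW
    omega
  have := Finset.sum_le_card_nsmul S _ w hS_le
  rwa [smul_eq_mul, Nat.mul_comm] at this

end Rotation

section LongestCycle

variable [DecidableEq V] {G : SimpleGraph V} {p y : ℕ → V} {c r : ℕ}

lemma IsCyc.exists_shift (h : IsCyc G p c) (hc : 0 < c) {v : V}
    (hv : v ∈ (Finset.range c).image p) :
    ∃ q, IsCyc G q c ∧ (Finset.range c).image q = (Finset.range c).image p ∧ q 0 = v := by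
  obtain ⟨s, -, rfl⟩ := Finset.mem_image.1 hv
  exact ⟨_, h.shift s, h.image_shift hc s, by simp⟩

lemma disjoint_image_of_notMem (hyC : ∀ j ≤ r, y j ∉ (Finset.range c).image p)
    {S : Finset V} (hS : S ⊆ (Finset.range c).image p) {j : ℕ} (hj : j ≤ r) :
    Disjoint ((Finset.Icc 0 j).image y) S := by
  rw [Finset.disjoint_left]
  intro v hv hvS
  obtain ⟨i, hi, rfl⟩ := Finset.mem_image.1 hv
  exact hyC i (by have := (Finset.mem_Icc.1 hi).2; omega) (hS hvS)

/-- The chords from the first vertex of a path ending next to `p 0` to a longest cycle `p`. -/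
lemma IsCyc.position_of_adj (h : IsCyc G p c) (hmax : ∀ m, c < m → ¬ HasCycle G m)
    (hy : IsPathFun G y r) (hyC : ∀ j ≤ r, y j ∉ (Finset.range c).image p)
    (hlast : G.Adj (y r) (p 0)) {j : ℕ} (hj : 1 ≤ j) (hjc : j < c) (hadj : G.Adj (y 0) (p j)) :
    r + 2 ≤ j ∧ j + r + 2 ≤ c := by
  have hY := hy.pathOn (Nat.zero_le r) le_rfl
  constructor
  · by_contra hlt
    have hd := h.disjoint_image (i := 0) (j := 0) (i' := j) (j' := c - 1)
      (by omega) (by omega) (by omega)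
    have hd' := disjoint_image_of_notMem hyC (Finset.union_subset
      (image_Icc_subset (p := p) (i := 0) (j := 0) (c := c) (by omega))
      (image_Icc_subset (i := j) (j := c - 1) (by omega))) le_rfl
    have hP := hY.append ((h.pathOn (i := 0) (j := 0) le_rfl (by omega)).append
      (h.pathOn (i := j) (j := c - 1) (by omega) (by omega)).symm
      (h.adj_last (by omega)).symm hd) hlast hd'
    refine hmax (c + r + 2 - j) (by omega) ⟨_, _, _, hP, hadj.symm, ?_⟩
    rw [Finset.card_union_of_disjoint hd', Finset.card_union_of_disjoint hd,
      hy.card_image_Icc le_rfl, h.card_image_Icc (by omega), h.card_image_Icc (by omega)]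
    omega
  · by_contra hlt
    have hd' := disjoint_image_of_notMem hyC
      (image_Icc_subset (p := p) (i := 0) (j := j) (c := c) hjc) le_rfl
    have hP := hY.append (h.pathOn (Nat.zero_le j) hjc) hlast hd'
    refine hmax (r + j + 2) (by omega) ⟨_, _, _, hP, hadj.symm, ?_⟩
    rw [Finset.card_union_of_disjoint hd', hy.card_image_Icc le_rfl, h.card_image_Icc hjc]
    omega

/-- A vertex outside a longest cycle has no two consecutive neighbours on it. -/
lemma IsCyc.not_adj_succ (h : IsCyc G p c) (hmax : ∀ m, c < m → ¬ HasCycle G m) {v : V}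
    (hv : v ∉ (Finset.range c).image p) {j : ℕ} (hjc : j + 1 < c) (hadj : G.Adj v (p j)) :
    ¬ G.Adj v (p (j + 1)) := by
  intro hadj'
  have hd := h.disjoint_image (i := j + 1) (j := c - 1) (i' := 0) (j' := j)
    (by omega) (by omega) (by omega)
  have hd' : Disjoint {v} ((Finset.Icc (j + 1) (c - 1)).image p ∪ (Finset.Icc 0 j).image p) := by
    rw [Finset.disjoint_singleton_left]
    exact fun hmem => hv (Finset.union_subset (image_Icc_subset (by omega))
      (image_Icc_subset (by omega)) hmem)
  have hP := (PathOn.single v).append ((h.pathOn (i := j + 1) (j := c - 1) (by omega)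
    (by omega)).append (h.pathOn (Nat.zero_le j) (by omega)) (h.adj_last (by omega)) hd) hadj' hd'
  refine hmax (c + 1) (by omega) ⟨_, _, _, hP, hadj.symm, ?_⟩
  rw [Finset.card_union_of_disjoint hd', Finset.card_union_of_disjoint hd,
    Finset.card_singleton, h.card_image_Icc (by omega), h.card_image_Icc (by omega)]
  omega

/-- If a vertex outside a longest cycle is adjacent to `p i` and `p (c - 1)`, then `p (i + 1)` and
`p 0` are not adjacent. -/
lemma IsCyc.not_adj_succ_succ (h : IsCyc G p c) (hmax : ∀ m, c < m → ¬ HasCycle G m) {v : V}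
    (hv : v ∉ (Finset.range c).image p) {i : ℕ} (hic : i + 1 < c) (hadj : G.Adj v (p i))
    (hadj' : G.Adj v (p (c - 1))) : ¬ G.Adj (p 0) (p (i + 1)) := by
  intro hchord
  have hd := h.disjoint_image (i := 0) (j := i) (i' := i + 1) (j' := c - 1)
    (by omega) (by omega) (by omega)
  have hd' : Disjoint {v} ((Finset.Icc 0 i).image p ∪ (Finset.Icc (i + 1) (c - 1)).image p) := by
    rw [Finset.disjoint_singleton_left]
    exact fun hmem => hv (Finset.union_subset (image_Icc_subset (by omega))
      (image_Icc_subset (by omega)) hmem)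
  have hP := (PathOn.single v).append ((h.pathOn (Nat.zero_le i) (by omega)).symm.append
    (h.pathOn (i := i + 1) (j := c - 1) (by omega) (by omega)) hchord hd) hadj hd'
  refine hmax (c + 1) (by omega) ⟨_, _, _, hP, hadj'.symm, ?_⟩
  rw [Finset.card_union_of_disjoint hd', Finset.card_union_of_disjoint hd,
    Finset.card_singleton, h.card_image_Icc (by omega), h.card_image_Icc (by omega)]
  omega

variable [DecidableRel G.Adj]

lemma IsCyc.two_mul_degOn_add_le (h : IsCyc G p c) (hmax : ∀ m, c < m → ¬ HasCycle G m)
    (hy : IsPathFun G y r) (hyC : ∀ j ≤ r, y j ∉ (Finset.range c).image p)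
    (hlast : G.Adj (y r) (p 0)) (hrc : 2 * r + 2 ≤ c) :
    2 * degOn G ((Finset.range c).image p) (y 0) + 2 * r ≤ c := by
  rw [h.degOn_image]
  set J := (Finset.Ico 1 c).filter fun j => G.Adj (y 0) (p j) with hJ
  have hsub : ((Finset.range c).filter fun j => G.Adj (y 0) (p j)) ⊆ insert 0 J := by
    intro j hj
    simp only [Finset.mem_filter, Finset.mem_range, Finset.mem_insert, J, Finset.mem_Ico] at hj ⊢
    rcases Nat.eq_zero_or_pos j with h0 | h0
    · exact Or.inl h0
    · exact Or.inr ⟨⟨h0, hj.1⟩, hj.2⟩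
  have hcard := (Finset.card_le_card hsub).trans (Finset.card_insert_le _ _)
  have hpos : ∀ j ∈ J, r + 2 ≤ j ∧ j + r + 2 ≤ c := by
    intro j hj
    simp only [J, Finset.mem_filter, Finset.mem_Ico] at hj
    exact h.position_of_adj hmax hy hyC hlast hj.1.1 hj.1.2 hj.2
  have hsucc : (J.image (· + 1)).card = J.card :=
    Finset.card_image_of_injective _ (add_left_injective 1)
  have hdisj : Disjoint J (J.image (· + 1)) := by
    rw [Finset.disjoint_left]
    intro j hj hj'
    obtain ⟨i, hi, rfl⟩ := Finset.mem_image.1 hj'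
    have := hpos _ hj
    exact h.not_adj_succ hmax (hyC 0 (Nat.zero_le _)) (by omega) (Finset.mem_filter.1 hi).2
      (Finset.mem_filter.1 hj).2
  have hunion : (J ∪ J.image (· + 1)).card ≤ (Finset.Ico (r + 2) (c - r)).card := by
    refine Finset.card_le_card (Finset.union_subset (fun j hj => ?_) fun j hj => ?_)
    · have := hpos j hj
      exact Finset.mem_Ico.2 (by omega)
    · obtain ⟨i, hi, rfl⟩ := Finset.mem_image.1 hj
      have := hpos i hi
      exact Finset.mem_Ico.2 (by omega)
  rw [Finset.card_union_of_disjoint hdisj, hsucc, Nat.card_Ico] at hunion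
  omega

/-- The successors on a longest cycle of the neighbours of an outside vertex are independent. -/
lemma IsCyc.adjPairs_add_le (h : IsCyc G p c) (hmax : ∀ m, c < m → ¬ HasCycle G m) {v : V}
    (hv : v ∉ (Finset.range c).image p) :
    adjPairs G ((Finset.range c).image p) + degOn G ((Finset.range c).image p) v *
      (degOn G ((Finset.range c).image p) v - 1) ≤ c * (c - 1) := by
  set C := (Finset.range c).image p with hC
  rcases Nat.eq_zero_or_pos c with rfl | hc
  · simp [hC, adjPairs, degOn]
  set J := (Finset.range c).filter fun j => G.Adj v (p j) with hJ
  set S := J.image fun j => p (j + 1) with hS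
  have hScard : S.card = degOn G C v := by
    rw [h.degOn_image, hS, Finset.card_image_of_injOn]
    intro i hi j hj
    exact (h.shift 1).inj i (Finset.mem_range.1 (Finset.mem_filter.1 hi).1) j
      (Finset.mem_range.1 (Finset.mem_filter.1 hj).1)
  have hSC : S ⊆ C := by
    rw [hC, ← h.image_shift hc 1]
    exact Finset.image_subset_image (Finset.filter_subset _ _)
  have key := adjPairs_add_le_of_independent (G := G) hSC ?_
  · rwa [hScard, h.card_image] at key
  intro s hs t ht hst
  obtain ⟨i, hi, rfl⟩ := Finset.mem_image.1 hs
  obtain ⟨j, hj, rfl⟩ := Finset.mem_image.1 ht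
  simp only [J, Finset.mem_filter, Finset.mem_range] at hi hj
  have hq := h.shift (i + 1)
  have himg := h.image_shift hc (i + 1)
  set d := (j + c - i - 1) % c with hd
  have hdc : d < c := Nat.mod_lt _ hc
  have hpd : ∀ e, p (d + (i + 1) + e) = p (j + e) := by
    intro e
    rw [← h.mod, hd, Nat.add_assoc, Nat.mod_add_mod,
      show j + c - i - 1 + (i + 1 + e) = j + e + c by omega, h.mod, h.periodic]
  have hne : d + 1 < c := by
    by_contra hge
    refine hst.ne ?_
    rw [← hpd 1, show d + (i + 1) + 1 = i + 1 + c by omega, h.periodic]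
  refine hq.not_adj_succ_succ hmax (v := v) (by rwa [himg]) hne ?_ ?_ ?_
  · simpa [hpd 0] using (hpd 0).symm ▸ hj.2
  · rw [show c - 1 + (i + 1) = i + c by omega, h.periodic]
    exact hi.2
  · rw [Nat.zero_add, show d + 1 + (i + 1) = d + (i + 1) + 1 by omega, hpd 1]
    exact hst

end LongestCycle

section Deletion

lemma exists_maximal_nat_of_bounded {Q : ℕ → Prop} {N : ℕ} (hN : ∀ r, Q r → r ≤ N)
    (h : ∃ r, Q r) :
    ∃ r, Q r ∧ ∀ s, r < s → ¬ Q s := by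
  classical
  obtain ⟨r, hr⟩ := h
  refine ⟨Nat.findGreatest Q N, Nat.findGreatest_spec (hN r hr) hr, fun s hs hQ => ?_⟩
  exact Nat.findGreatest_is_greatest hs (hN s hQ) hQ

variable [DecidableEq V] {G : SimpleGraph V} [DecidableRel G.Adj] {p : ℕ → V} {c D : ℕ}
  {U : Finset V}

/-- Some vertices of `U` can be deleted without losing many edges. -/
def Reducible (G : SimpleGraph V) [DecidableRel G.Adj] (C U : Finset V) (D : ℕ) : Prop :=
  ∃ S ⊆ U, S.Nonempty ∧
    ∑ s ∈ S, (degOn G ((C ∪ U) \ S) s + degOn G (C ∪ U) s) ≤ D * S.card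

lemma reducible_of_no_edges {C : Finset V} (hmax : ∀ m, c < m → ¬ HasCycle G m)
    (hUne : U.Nonempty) (hD : min c (U.card + 1) ≤ D) (hno : ∀ u ∈ U, ∀ v ∈ C, ¬ G.Adj u v) :
    Reducible G C U D := by
  obtain ⟨r, ⟨y₀, hy₀, hy₀U⟩, hr⟩ := exists_maximal_nat_of_bounded (N := U.card)
    (Q := fun r => ∃ y, IsPathFun G y r ∧ ∀ j ≤ r, y j ∈ U)
    (fun r ⟨y, hy, hyU⟩ => (hy.lt_card hyU).le) (by
      obtain ⟨u, hu⟩ := hUne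
      exact ⟨0, fun _ => u, ⟨fun i hi j hj _ => by omega, fun i hi => by omega⟩, fun _ _ => hu⟩)
  obtain ⟨S, hSne, hS, hsum⟩ := exists_sum_degOn_le_of_rotate (X := C ∪ U) (R := r) (c := c)
    (P := fun y => IsPathFun G y r ∧ ∀ j ≤ r, y j ∈ U) hmax (fun y hy => hy.1)
    (fun y hy i h1 hi hadj => ⟨hy.1.rotate hi hadj, fun j hj => by
      rw [rotate]
      split_ifs
      · exact hy.2 _ (by omega)
      · exact hy.2 _ hj⟩)
    (fun y hy j hj => Finset.mem_union_right _ (hy.2 j hj))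
    (fun y hy v hv hadj => by
      by_contra! hnot
      rcases Finset.mem_union.1 hv with hv | hv
      · exact hno _ (hy.2 0 (Nat.zero_le _)) v hv hadj
      · refine hr (r + 1) (by omega) ⟨_, hy.1.cons hadj hnot, fun j hj => ?_⟩
        split_ifs
        · exact hv
        · exact hy.2 _ (by omega))
    ⟨y₀, hy₀, hy₀U⟩
  refine ⟨S, fun s hs => ?_, hSne, hsum.trans (Nat.mul_le_mul_right _ ?_)⟩
  · obtain ⟨y, hy, rfl⟩ := hS s hs
    exact hy.2 0 (Nat.zero_le _)
  · have := hy₀.lt_card hy₀U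
    omega

lemma IsCyc.reducible (h : IsCyc G p c) (hc : 0 < c) (hmax : ∀ m, c < m → ¬ HasCycle G m)
    (hU : Disjoint ((Finset.range c).image p) U) (hUne : U.Nonempty) (hcD : c ≤ D + 1)
    (hD : min c (U.card + 1) ≤ D)
    (hdeg : c ≤ D ∨ ∀ x ∈ U, 2 * degOn G ((Finset.range c).image p) x ≤ D) :
    Reducible G ((Finset.range c).image p) U D := by
  set C := (Finset.range c).image p with hC
  by_cases hno : ∀ u ∈ U, ∀ v ∈ C, ¬ G.Adj u v
  · exact reducible_of_no_edges hmax hUne hD hno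
  push Not at hno
  obtain ⟨u₀, hu₀, v₀, hv₀, huv₀⟩ := hno
  have hUC : ∀ v ∈ U, v ∉ C := fun v hv hvC => Finset.disjoint_left.1 hU hvC hv
  set Q : ℕ → (ℕ → V) → Prop := fun r y =>
    IsPathFun G y (r + 1) ∧ (∀ j ≤ r, y j ∈ U) ∧ y (r + 1) ∈ C with hQ
  obtain ⟨r, ⟨y₀, hy₀⟩, hr⟩ := exists_maximal_nat_of_bounded (N := U.card)
    (Q := fun r => ∃ y, Q r y)
    (fun r ⟨y, hy, hyU, _⟩ => ((hy.mono (Nat.le_succ r)).lt_card hyU).le) (by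
      have hne : ∀ j ≤ 0, v₀ ≠ (fun _ : ℕ => u₀) j := fun j _ hvu =>
        hUC u₀ hu₀ ((show v₀ = u₀ from hvu) ▸ hv₀)
      have := IsPathFun.reverse_concat (G := G) (y := fun _ => u₀) (r := 0)
        ⟨fun i hi j hj _ => by omega, fun i hi => by omega⟩ huv₀ hne
      exact ⟨0, _, this, fun j hj => by simpa [Nat.le_zero.1 hj] using hu₀, by simpa using hv₀⟩)
  have hrU := (hy₀.1.mono (Nat.le_succ r)).lt_card hy₀.2.1
  have hnbr : ∀ y, Q r y → ∀ v ∈ U, G.Adj (y 0) v → ∃ j ≤ r, v = y j := by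
    intro y hy v hv hadj
    by_contra! hnot
    refine hr (r + 1) (by omega) ⟨_, hy.1.cons hadj fun j hj => ?_, fun j hj => ?_, ?_⟩
    · rcases Nat.lt_or_ge r j with hrj | hrj
      · obtain rfl : j = r + 1 := by omega
        rintro rfl
        exact hUC _ hv hy.2.2
      · exact hnot j hrj
    · split_ifs
      · exact hv
      · exact hy.2.1 _ (by omega)
    · simpa using hy.2.2
  rcases Nat.lt_or_ge c (2 * r + 4) with hcr | hcr
  · obtain ⟨S, hSne, hS, hsum⟩ := exists_sum_degOn_le_of_rotate (X := C ∪ U) (R := r + 1) (c := c)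
      (P := Q r) hmax (fun y hy => hy.1)
      (fun y hy i h1 hi hadj => ⟨hy.1.rotate hi hadj, fun j hj => by
        rw [rotate]
        split_ifs
        · exact hy.2.1 _ (by omega)
        · exact hy.2.1 _ hj, by
        rw [rotate_of_le y hi]
        exact hy.2.2⟩)
      (fun y hy j hj => by
        rcases Nat.lt_or_ge r j with hrj | hrj
        · obtain rfl : j = r + 1 := by omega
          exact Finset.mem_union_left _ hy.2.2
        · exact Finset.mem_union_right _ (hy.2.1 j hrj))
      (fun y hy v hv hadj => by
        rcases Finset.mem_union.1 hv with hv | hv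
        · refine ⟨r + 1, le_rfl, ?_⟩
          obtain ⟨q, hq, hqC, hq0⟩ := h.exists_shift hc hy.2.2
          rw [← hC] at hqC
          rw [← hqC] at hv
          obtain ⟨j, hj, rfl⟩ := Finset.mem_image.1 hv
          rw [Finset.mem_range] at hj
          rcases Nat.eq_zero_or_pos j with rfl | hj0
          · exact hq0
          · have := hq.position_of_adj hmax (hy.1.mono (Nat.le_succ r))
              (fun j hj => hqC ▸ hUC _ (hy.2.1 j hj)) (hq0 ▸ hy.1.adj r (by omega)) hj0 hj hadj
            omega
        · obtain ⟨j, hj, hvj⟩ := hnbr y hy v hv hadj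
          exact ⟨j, by omega, hvj⟩)
      ⟨y₀, hy₀⟩
    refine ⟨S, fun s hs => ?_, hSne, hsum.trans (Nat.mul_le_mul_right _ (by omega))⟩
    obtain ⟨y, hy, rfl⟩ := hS s hs
    exact hy.2.1 0 (Nat.zero_le _)
  · have hdegU : ∀ y, Q r y → U.filter (G.Adj (y 0)) ⊆ (Finset.Icc 1 r).image y := by
      intro y hy v hv
      obtain ⟨hv, hadj⟩ := Finset.mem_filter.1 hv
      obtain ⟨j, hj, rfl⟩ := hnbr y hy v hv hadj
      have : j ≠ 0 := by rintro rfl; exact G.loopless.irrefl _ hadj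
      exact Finset.mem_image_of_mem _ (Finset.mem_Icc.2 (by omega))
    have hdegU' : ∀ y, Q r y → degOn G U (y 0) ≤ r := fun y hy =>
      (Finset.card_le_card (hdegU y hy)).trans (Finset.card_image_le.trans (by simp))
    have hdegC : ∀ y, Q r y → 2 * degOn G C (y 0) + 2 * r ≤ c := by
      intro y hy
      obtain ⟨q, hq, hqC, hq0⟩ := h.exists_shift hc hy.2.2
      rw [← hC] at hqC
      have := hq.two_mul_degOn_add_le hmax (hy.1.mono (Nat.le_succ r))
        (fun j hj => hqC ▸ hUC _ (hy.2.1 j hj)) (hq0 ▸ hy.1.adj r (by omega)) (by omega)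
      rwa [hqC] at this
    have hdegX : ∀ v, degOn G (C ∪ U) v = degOn G C v + degOn G U v := fun v => degOn_union hU v
    have hU₀ := hdegU' y₀ hy₀
    have hC₀ := hdegC y₀ hy₀
    by_cases hsmall : 2 * degOn G (C ∪ U) (y₀ 0) ≤ D
    · refine ⟨{y₀ 0}, by simpa using hy₀.2.1 0 (Nat.zero_le _), Finset.singleton_nonempty _, ?_⟩
      have := degOn_mono (G := G) (Finset.sdiff_subset (s := C ∪ U) (t := {y₀ 0})) (y₀ 0)
      rw [Finset.sum_singleton, Finset.card_singleton]
      omega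
    rw [hdegX] at hsmall
    have hdegD := hdeg.resolve_left (by omega) _ (hy₀.2.1 0 (Nat.zero_le _))
    have hr0 : 1 ≤ r := by omega
    have hadj : G.Adj (y₀ 0) (y₀ r) := by
      have heq : U.filter (G.Adj (y₀ 0)) = (Finset.Icc 1 r).image y₀ := by
        refine Finset.eq_of_subset_of_card_le (hdegU y₀ hy₀) ?_
        refine Finset.card_image_le.trans ?_
        rw [Nat.card_Icc, ← degOn]
        omega
      have : y₀ r ∈ (Finset.Icc 1 r).image y₀ :=
        Finset.mem_image_of_mem _ (Finset.mem_Icc.2 ⟨hr0, le_rfl⟩)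
      rw [← heq] at this
      exact (Finset.mem_filter.1 this).2
    obtain ⟨v, hv⟩ := Finset.card_pos.1 (show 0 < degOn G C (y₀ 0) by omega)
    obtain ⟨hvC, hv⟩ := Finset.mem_filter.1 hv
    have hz : Q r (fun j => if j ≤ r then y₀ (r - j) else v) := by
      refine ⟨(hy₀.1.mono (Nat.le_succ r)).reverse_concat hv ?_, fun j hj => ?_, by simpa using hvC⟩
      · rintro j hj rfl
        exact hUC _ (hy₀.2.1 j hj) hvC
      · simpa [hj] using hy₀.2.1 (r - j) (by omega)
    have hUr := hdegU' _ hz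
    have hCr := hdegC _ hz
    simp only [Nat.zero_le, ↓reduceIte, Nat.sub_zero] at hUr hCr
    have hmem₀ := hy₀.2.1 0 (Nat.zero_le _)
    have hmem₁ := hy₀.2.1 r le_rfl
    have hsub : {y₀ 0, y₀ r} ⊆ U := by
      rw [Finset.insert_subset_iff, Finset.singleton_subset_iff]
      exact ⟨hmem₀, hmem₁⟩
    refine ⟨{y₀ 0, y₀ r}, hsub, Finset.insert_nonempty _ _, ?_⟩
    have hpos : ∀ a b, G.Adj a b → b ∈ ({y₀ 0, y₀ r} : Finset V) →
        0 < degOn G {y₀ 0, y₀ r} a := fun a b hab hb =>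
      Finset.card_pos.2 ⟨b, Finset.mem_filter.2 ⟨hb, hab⟩⟩
    have h₁ := hpos _ _ hadj (by simp)
    have h₂ := hpos _ _ hadj.symm (by simp)
    have h₃ := degOn_sdiff_add (G := G) (hsub.trans (Finset.subset_union_right (s₁ := C))) (y₀ 0)
    have h₄ := degOn_sdiff_add (G := G) (hsub.trans (Finset.subset_union_right (s₁ := C))) (y₀ r)
    rw [Finset.sum_pair hadj.ne, Finset.card_pair hadj.ne]
    rw [hdegX] at h₃ h₄
    rw [hdegX, hdegX]
    omega

lemma IsCyc.adjPairs_union_le (h : IsCyc G p c) (hc : 0 < c) (hmax : ∀ m, c < m → ¬ HasCycle G m)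
    (hcD : c ≤ D + 1) (hU : Disjoint ((Finset.range c).image p) U)
    (hD : min c (U.card + 1) ≤ D)
    (hdeg : c ≤ D ∨ ∀ x ∈ U, 2 * degOn G ((Finset.range c).image p) x ≤ D) :
    adjPairs G ((Finset.range c).image p ∪ U) ≤
      adjPairs G ((Finset.range c).image p) + D * U.card := by
  induction U using Finset.strongInduction with
  | H U ih =>
    rcases U.eq_empty_or_nonempty with rfl | hUne
    · simp
    obtain ⟨S, hSU, hSne, hsum⟩ := h.reducible hc hmax hU hUne hcD hD hdeg
    have hcard := Finset.card_sdiff_add_card_eq_card hSU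
    have hrest := ih (U \ S) (Finset.sdiff_ssubset hSU hSne) (hU.mono_right Finset.sdiff_subset)
      (by omega) (hdeg.imp_right fun hx x hxU => hx x (Finset.mem_sdiff.1 hxU).1)
    have hSX : S ⊆ (Finset.range c).image p ∪ U := hSU.trans Finset.subset_union_right
    have hX : ((Finset.range c).image p ∪ U) \ S = (Finset.range c).image p ∪ (U \ S) := by
      rw [Finset.union_sdiff_distrib, Finset.sdiff_eq_self_of_disjoint (hU.mono_right hSU)]
    rw [adjPairs_sdiff hSX, ← hcard, Nat.mul_add, ← Nat.add_assoc]
    exact Nat.add_le_add (hX ▸ hrest) hsum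

end Deletion

section Extremal

variable {G : SimpleGraph V}

lemma cycleFree_of_colorable {k : ℕ} (hk : 2 ≤ k) (h : G.Colorable 2) :
    CycleFree G (2 * k + 1) := by
  intro f _
  have h3 := SimpleGraph.chromaticNumber_cycleGraph_of_odd (2 * k + 1) (by omega) ⟨k, rfl⟩
  have h2 := (SimpleGraph.chromaticNumber_le_iff_colorable).2 (h.of_hom f)
  rw [h3] at h2
  exact absurd h2 (by decide)

variable [DecidableEq V]

lemma HasCycle.le_card [Fintype V] {m : ℕ} (h : HasCycle G m) : m ≤ Fintype.card V := by
  obtain ⟨a, b, S, -, -, rfl⟩ := h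
  exact S.card_le_univ

lemma not_hasCycle_of_cycleFree {m : ℕ} (hm : 2 ≤ m) (h : CycleFree G m) : ¬ HasCycle G m := by
  intro hcyc
  obtain ⟨p, hp⟩ := hcyc.exists_isCyc
  have key : ∀ u v : Fin m, (u - v).val = 1 → G.Adj (p v) (p u) := by
    intro u v huv
    have : u.val = (v.val + 1) % m := by
      have : NeZero m := ⟨by omega⟩
      have h1 : u = v + (u - v) := by simp
      rw [h1, Fin.val_add, huv]
    rw [this, hp.mod]
    exact hp.adj v
  refine h ⟨fun i => p i, fun {u v} huv => ?_⟩ fun i j hij => Fin.ext (hp.inj i i.2 j j.2 hij)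
  rcases SimpleGraph.cycleGraph_adj'.1 huv with huv | huv
  · exact (key u v huv).symm
  · exact key v u huv

lemma two_mul_adjPairs_univ_le [Fintype V] [DecidableRel G.Adj] {k : ℕ} (hk : 2 ≤ k)
    (hn : 4 * k - 2 ≤ Fintype.card V) (hno : ¬ HasCycle G (2 * k + 1)) :
    2 * adjPairs G Finset.univ ≤ Fintype.card V ^ 2 := by
  set n := Fintype.card V
  by_cases hedge : ∀ a b, ¬ G.Adj a b
  · have : adjPairs G Finset.univ = 0 :=
      Finset.sum_eq_zero fun v _ => by simp [degOn, hedge]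
    omega
  push Not at hedge
  obtain ⟨a, b, hab⟩ := hedge
  have h2 : HasCycle G 2 := by
    refine ⟨a, b, {a, b}, ?_, hab.symm, Finset.card_pair hab.ne⟩
    exact PathOn.cons hab (by simpa using hab.ne) (PathOn.single b)
  obtain ⟨c, hcyc, hmax⟩ := exists_maximal_nat_of_bounded (Q := HasCycle G) (N := n)
    (fun m hm => hm.le_card) ⟨2, h2⟩
  have hc2 : 2 ≤ c := by
    by_contra hlt
    exact hmax 2 (by omega) h2
  have hcn : c ≤ n := hcyc.le_card
  obtain ⟨p, hp⟩ := hcyc.exists_isCyc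
  set C := (Finset.range c).image p with hC
  have hCcard : C.card = c := hp.card_image
  have hCU : C ∪ Cᶜ = Finset.univ := Finset.union_compl C
  have hUcard : Cᶜ.card = n - c := by rw [Finset.card_compl, hCcard]
  have hE := hp.adjPairs_union_le (U := Cᶜ) (D := c) (by omega) hmax (by omega)
    disjoint_compl_right (min_le_left _ _) (Or.inl le_rfl)
  rw [← hC, hCU, hUcard] at hE
  have hEC := adjPairs_le (G := G) C
  rw [hCcard] at hEC
  obtain ⟨u, hu⟩ : ∃ u, n = c + u := ⟨n - c, by omega⟩
  rw [hu, Nat.add_sub_cancel_left] at hE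
  obtain ⟨d, rfl⟩ : ∃ d, c = d + 1 := ⟨c - 1, by omega⟩
  rw [Nat.add_sub_cancel] at hEC
  rcases Nat.lt_or_ge (2 * k) (d + 1) with hck | hck
  · have := two_mul_adjPairs_image_le hp (l := 2 * k + 1) (by omega) (by omega) hno
    rw [← hC] at this
    rw [hu]
    nlinarith
  have hbound : 2 * adjPairs G Finset.univ ≤ 2 * ((d + 1) * (d + u)) := by nlinarith
  rcases Nat.lt_or_ge (4 * k - 2) n with hn' | hn'
  · refine hbound.trans ?_
    have h₁ : (d + 1) * (d + u) ≤ 2 * k * (d + u) := Nat.mul_le_mul_right _ hck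
    obtain ⟨t, ht⟩ : ∃ t, d + u + 2 = 4 * k + t := ⟨d + u + 2 - 4 * k, by omega⟩
    have ht' : n = d + u + 1 := by omega
    rw [ht']
    nlinarith [Nat.zero_le (t * k), Nat.zero_le (t * t)]
  have hnk : n = 4 * k - 2 := by omega
  obtain ⟨l, rfl⟩ : ∃ l, k = l + 2 := ⟨k - 2, by omega⟩
  rcases Nat.lt_or_ge (d + 1) (2 * (l + 2)) with hck' | hck'
  · refine hbound.trans ?_
    have h₁ : (d + 1) * (d + u) ≤ (2 * l + 3) * (d + u) := Nat.mul_le_mul_right _ (by omega)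
    have h₂ : d + u = 4 * l + 5 := by omega
    rw [h₂] at h₁ ⊢
    rw [show n = 4 * l + 6 by omega]
    nlinarith
  obtain rfl : d = 2 * l + 3 := by omega
  obtain rfl : u = 2 * l + 2 := by omega
  rw [show n = 4 * l + 6 by omega]
  by_cases hlow : ∀ x ∈ Cᶜ, 2 * degOn G C x ≤ 2 * l + 3
  · have hE' := hp.adjPairs_union_le (U := Cᶜ) (D := 2 * l + 3) (by omega) hmax (by omega)
      disjoint_compl_right (by omega) (Or.inr hlow)
    rw [← hC, hCU, hUcard, hu, Nat.add_sub_cancel_left] at hE'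
    nlinarith
  · push Not at hlow
    obtain ⟨x, hx, hdx⟩ := hlow
    have hE' := hp.adjPairs_add_le hmax (Finset.mem_compl.1 hx)
    rw [← hC] at hE'
    have : (l + 2) * (l + 1) ≤ degOn G C x * (degOn G C x - 1) :=
      Nat.mul_le_mul (by omega) (by omega)
    rw [Nat.add_sub_cancel] at hE'
    nlinarith

end Extremal

/-- Theorem: for `k ≥ 2` and `n ≥ 4k - 2`, `ex(n, C_{2k+1}) = ⌊n²/4⌋`: every
`C_{2k+1}`-free graph on `n` vertices has at most `⌊n²/4⌋` edges, and some `C_{2k+1}`-free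
graph on `n` vertices has exactly `⌊n²/4⌋` edges. -/
theorem stmt18 (k n : ℕ) (hk : 2 ≤ k) (hn : 4 * k - 2 ≤ n) :
    (∀ G : SimpleGraph (Fin n), CycleFree G (2 * k + 1) → G.edgeSet.ncard ≤ n ^ 2 / 4) ∧
    (∃ G : SimpleGraph (Fin n), CycleFree G (2 * k + 1) ∧ G.edgeSet.ncard = n ^ 2 / 4) := by
  classical
  refine ⟨fun G hG => ?_, SimpleGraph.turanGraph n 2, cycleFree_of_colorable hk ?_, ?_⟩
  · have h := two_mul_adjPairs_univ_le hk (by simpa using hn)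
      (not_hasCycle_of_cycleFree (by omega) hG)
    rw [adjPairs_univ, Fintype.card_fin] at h
    omega
  · refine ⟨SimpleGraph.Coloring.mk (fun v => ⟨v % 2, Nat.mod_lt _ two_pos⟩) fun {u v} huv => ?_⟩
    simpa [Fin.ext_iff] using SimpleGraph.turanGraph_adj.1 huv
  · rw [← SimpleGraph.coe_edgeFinset, Set.ncard_coe_finset, SimpleGraph.card_edgeFinset_turanGraph]
    rcases Nat.mod_two_eq_zero_or_one n with h | h
    · simp [h]
    · simp only [h, one_pow, Nat.choose_succ_self]
      have : n ^ 2 % 4 = 1 := by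
        obtain ⟨m, rfl⟩ : ∃ m, n = 2 * m + 1 := ⟨n / 2, by omega⟩
        ring_nf
        omega
      omega
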